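/- arXiv:2211.06297 — 8 statements merged into one kernel-verified Lean document; each statement's English description precedes it below -/
import Mathlib

section
/- Let (L, ∧, ∨, ⊙, →, 0, 1) be a commutative residuated lattice. Then L is a BL-algebra (i.e., satisfies both prelinearity and divisibility) if and only if for all x, y, z ∈ L, whenever x ⊙ (x → y) ≤ z one has (x → z) ∨ (y → z) = 1. -/
/-- A commutative residuated lattice: a bounded lattice which is a commutative
ordered monoid (with unit `1 = ⊤`) equipped with a residuum `rimp` satisfying
the residuation law `z ≤ x ⇨ y ↔ x * z ≤ y`. -/
class CommResiduatedLattice (L : Type*) extends Lattice L, CommMonoid L, BoundedOrder L where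
  /-- the residuum (implication) -/
  rimp : L → L → L
  /-- multiplication is monotone -/
  mul_le_mul_left : ∀ a b : L, a ≤ b → ∀ c : L, c * a ≤ c * b
  /-- residuation -/
  residuation : ∀ x y z : L, z ≤ rimp x y ↔ x * z ≤ y
  /-- the unit of the monoid is the top of the lattice -/
  top_eq_one : (⊤ : L) = 1


open CommResiduatedLattice in
theorem bl_iff_mul_imp_le_implies_join_eq_one {L : Type*} [CommResiduatedLattice L] :
    ((∀ x y : L, rimp x y ⊔ rimp y x = 1) ∧ (∀ x y : L, x * rimp x y = x ⊓ y)) ↔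
      (∀ x y z : L, x * rimp x y ≤ z → rimp x z ⊔ rimp y z = 1) := by
  have mp (x y : L) : x * rimp x y ≤ y := (residuation x y _).1 le_rfl
  have mul_le (x y : L) : x * y ≤ x := by
    simpa using mul_le_mul_left y 1 (top_eq_one (L := L) ▸ le_top) x
  have anti {x y : L} (h : x ≤ y) (z : L) : rimp y z ≤ rimp x z := by
    rw [residuation, mul_comm]
    refine (mul_le_mul_left x y h _).trans ?_
    rw [mul_comm]
    exact mp y z
  have mono (x : L) {y z : L} (h : y ≤ z) : rimp x y ≤ rimp x z :=
    (residuation x z _).2 ((mp x y).trans h)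
  constructor
  · rintro ⟨prel, div⟩ x y z h
    have hx : rimp x y ≤ rimp x z := (residuation x z _).2 h
    have hy : rimp y x ≤ rimp y z := by
      rw [residuation, div, inf_comm, ← div]
      exact h
    rw [← top_eq_one, eq_top_iff, top_eq_one, ← prel x y]
    exact sup_le_sup hx hy
  · intro h
    refine ⟨fun x y => ?_, fun x y => ?_⟩
    · rw [← top_eq_one, eq_top_iff, top_eq_one, ← h x y _ le_rfl]
      exact sup_le_sup (mono x (mp x y)) (mono y (mul_le x _))
    · refine le_antisymm (le_inf (mul_le x _) (mp x y)) ?_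
      have one_le : 1 ≤ rimp (x ⊓ y) (x * rimp x y) := by
        rw [← h x y _ le_rfl]
        exact sup_le (anti inf_le_left _) (anti inf_le_right _)
      simpa using (residuation _ _ _).1 one_le
end

section
/- Let (L, ∧, ∨, ⊙, →, 0, 1) be a commutative residuated lattice. Then L is a BL-algebra (i.e., satisfies both prelinearity and divisibility) if and only if for all x, y, z ∈ L, [x ⊙ (x → y)] → z = (x → z) ∨ (y → z). -/
namespace CommResiduatedLattice

variable {L : Type*} [CommResiduatedLattice L]

theorem mul_rimp_le_right (x y : L) : x * rimp x y ≤ y :=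
  (residuation x y _).1 le_rfl

theorem mul_le_mul_both {a b c d : L} (hab : a ≤ b) (hcd : c ≤ d) : a * c ≤ b * d := by
  refine (mul_le_mul_left c d hcd a).trans ?_
  rw [mul_comm a, mul_comm b]
  exact mul_le_mul_left a b hab d

theorem le_one_of_top (a : L) : a ≤ 1 := top_eq_one (L := L) ▸ le_top

theorem mul_le_left_factor (a b : L) : a * b ≤ a := by
  simpa using mul_le_mul_left b 1 (le_one_of_top b) a

theorem rimp_eq_one_of_le {a b : L} (h : a ≤ b) : rimp a b = 1 :=
  le_antisymm (le_one_of_top _) ((residuation a b 1).2 (by simpa using h))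

theorem rimp_mono_right (a : L) {b c : L} (h : b ≤ c) : rimp a b ≤ rimp a c :=
  (residuation a c _).2 ((mul_rimp_le_right a b).trans h)

theorem rimp_anti_left {a b : L} (h : a ≤ b) (c : L) : rimp b c ≤ rimp a c :=
  (residuation a c _).2 ((mul_le_mul_both h le_rfl).trans (mul_rimp_le_right b c))

/-- If `b ⊔ c = 1`, an element lies below `d` as soon as its products with `b` and `c` do. -/
theorem le_of_mul_le_of_sup_eq_one {a b c d : L} (h : b ⊔ c = 1)
    (hb : a * b ≤ d) (hc : a * c ≤ d) : a ≤ d := by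
  have key : b ⊔ c ≤ rimp a d :=
    sup_le ((residuation a d b).2 hb) ((residuation a d c).2 hc)
  simpa [h] using (residuation a d _).1 key

theorem rimp_inf_eq_sup (hprel : ∀ x y : L, rimp x y ⊔ rimp y x = 1)
    (hdiv : ∀ x y : L, x * rimp x y = x ⊓ y) (x y z : L) :
    rimp (x ⊓ y) z = rimp x z ⊔ rimp y z := by
  refine le_antisymm (le_of_mul_le_of_sup_eq_one (hprel x y) ?_ ?_)
    (sup_le (rimp_anti_left inf_le_left z) (rimp_anti_left inf_le_right z))
  · refine le_trans ((residuation x z _).2 ?_) le_sup_left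
    rw [mul_left_comm, hdiv, mul_comm]
    exact mul_rimp_le_right _ _
  · refine le_trans ((residuation y z _).2 ?_) le_sup_right
    rw [mul_left_comm, hdiv, inf_comm y x, mul_comm]
    exact mul_rimp_le_right _ _

end CommResiduatedLattice

open CommResiduatedLattice in
theorem bl_iff_imp_mul_imp_eq_join {L : Type*} [CommResiduatedLattice L] :
    ((∀ x y : L, rimp x y ⊔ rimp y x = 1) ∧ (∀ x y : L, x * rimp x y = x ⊓ y)) ↔
      (∀ x y z : L, rimp (x * rimp x y) z = rimp x z ⊔ rimp y z) := by
  constructor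
  · rintro ⟨hprel, hdiv⟩ x y z
    rw [hdiv]
    exact rimp_inf_eq_sup hprel hdiv x y z
  · intro h
    have hone (x y : L) : rimp x (x * rimp x y) ⊔ rimp y (x * rimp x y) = 1 := by
      rw [← h, rimp_eq_one_of_le le_rfl]
    refine ⟨fun x y => le_antisymm (le_one_of_top _) ?_, fun x y => le_antisymm
      (le_inf (mul_le_left_factor _ _) (mul_rimp_le_right _ _)) ?_⟩
    · rw [← hone x y]
      exact sup_le_sup (rimp_mono_right x (mul_rimp_le_right x y))
        (rimp_mono_right y (mul_le_left_factor x _))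
    · exact le_of_mul_le_of_sup_eq_one (hone x y)
        ((mul_le_mul_both inf_le_left le_rfl).trans (mul_rimp_le_right _ _))
        ((mul_le_mul_both inf_le_right le_rfl).trans (mul_rimp_le_right _ _))
end

section
/- Let A be a commutative unitary ring. Then A is a BL-ring (i.e., for all ideals I, J of A, (J : I) + (I : J) = A and I · (J : I) = I ∩ J) if and only if for all ideals I, J, K of A, (K : (I · (J : I))) = (K : I) + (K : J). -/
theorem blRing_iff_colon_mul_colon_eq_add_colon (A : Type*) [CommRing A] :
    (∀ I J : Ideal A, Submodule.colon J I + Submodule.colon I J = ⊤ ∧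
        I * Submodule.colon J I = I ⊓ J) ↔
      (∀ I J K : Ideal A,
        Submodule.colon K (I * Submodule.colon J I) =
          Submodule.colon K I + Submodule.colon K J) := by
  have mul_colon_le (I J : Ideal A) : I * Submodule.colon J (I : Set A) ≤ I ⊓ J := by
    refine le_inf Ideal.mul_le_left (Ideal.mul_le.2 fun x hx y hy => ?_)
    simpa [mul_comm] using Submodule.mem_colon.1 hy x hx
  constructor
  · intro h I J K
    obtain ⟨hadd, hmul⟩ := h I J
    rw [hmul]
    apply le_antisymm
    · intro x hx
      obtain ⟨a, ha, b, hb, hab⟩ := Submodule.mem_sup.1 ((Ideal.eq_top_iff_one _).1 hadd)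
      rw [Submodule.mem_colon] at hx ha hb
      refine Submodule.mem_sup.2 ⟨x * a, ?_, x * b, ?_, by rw [← mul_add, hab, mul_one]⟩
      · refine Submodule.mem_colon.2 fun s hs => ?_
        rw [mul_smul]
        exact hx _ ⟨I.mul_mem_left a hs, ha s hs⟩
      · refine Submodule.mem_colon.2 fun s hs => ?_
        rw [mul_smul]
        exact hx _ ⟨hb s hs, J.mul_mem_left b hs⟩
    · exact sup_le (Submodule.colon_mono le_rfl fun _ hx => hx.1)
        (Submodule.colon_mono le_rfl fun _ hx => hx.2)
  · intro h I J
    constructor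
    · have htop := h I J (I ⊓ J)
      rw [(Submodule.colon_eq_top_iff_subset _).2 (mul_colon_le I J)] at htop
      refine top_le_iff.1 (htop.le.trans ?_)
      exact sup_le_sup (Submodule.colon_mono inf_le_right subset_rfl)
        (Submodule.colon_mono inf_le_left subset_rfl)
    · refine le_antisymm (mul_colon_le I J) fun x hx => ?_
      have htop := h I J (I * Submodule.colon J (I : Set A))
      rw [(Submodule.colon_eq_top_iff_subset _).2 subset_rfl] at htop
      obtain ⟨a, ha, b, hb, hab⟩ := Submodule.mem_sup.1 ((Ideal.eq_top_iff_one _).1 htop.symm)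
      rw [← one_mul x, ← hab, add_mul]
      exact add_mem (Submodule.mem_colon.1 ha x hx.1) (Submodule.mem_colon.1 hb x hx.2)
end

section
/- Let A be a commutative ring which is a principal ideal domain. Then A is a BL-ring: for all ideals I, J of A, (J : I) + (I : J) = A and I · (J : I) = I ∩ J. -/
theorem Ideal.mul_colon_eq_inf_of_isPrincipal {A : Type*} [CommRing A] (I J : Ideal A)
    [I.IsPrincipal] : I * Submodule.colon J I = I ⊓ J := by
  obtain ⟨a, rfl⟩ := (inferInstance : I.IsPrincipal)
  apply le_antisymm
  · refine le_inf Ideal.mul_le_left (Ideal.mul_le.2 fun r hr s hs => ?_)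
    rw [mul_comm]
    exact Submodule.mem_colon.1 hs r hr
  · rintro x ⟨hxa, hxJ⟩
    obtain ⟨r, rfl⟩ := Ideal.mem_span_singleton.1 hxa
    refine Ideal.mul_mem_mul (Ideal.mem_span_singleton_self a) ?_
    rw [Ideal.submodule_span_eq, Ideal.mem_colon_span_singleton, mul_comm]
    exact hxJ

theorem Ideal.colon_add_colon_eq_top {A : Type*} [CommRing A] [IsDomain A]
    [IsPrincipalIdealRing A] (I J : Ideal A) :
    Submodule.colon J I + Submodule.colon I J = ⊤ := by
  by_cases h : I ⊔ J = ⊥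
  · obtain ⟨rfl, rfl⟩ := sup_eq_bot_iff.1 h
    simp
  obtain ⟨a, rfl⟩ := IsPrincipalIdealRing.principal I
  obtain ⟨b, rfl⟩ := IsPrincipalIdealRing.principal J
  simp only [Ideal.submodule_span_eq] at h ⊢
  obtain ⟨d, hd⟩ := IsPrincipalIdealRing.principal (Ideal.span {a} ⊔ Ideal.span {b})
  rw [Ideal.submodule_span_eq] at hd
  have hd0 : d ≠ 0 := by
    rintro rfl
    exact h (by simpa using hd)
  have ha : a ∈ Ideal.span {d} := hd ▸ Ideal.mem_sup_left (Ideal.mem_span_singleton_self a)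
  have hb : b ∈ Ideal.span {d} := hd ▸ Ideal.mem_sup_right (Ideal.mem_span_singleton_self b)
  have hdab : d ∈ Ideal.span {a} ⊔ Ideal.span {b} := hd ▸ Ideal.mem_span_singleton_self d
  obtain ⟨a', rfl⟩ := Ideal.mem_span_singleton.1 ha
  obtain ⟨b', rfl⟩ := Ideal.mem_span_singleton.1 hb
  rw [← Ideal.span_insert, Ideal.mem_span_pair] at hdab
  obtain ⟨u, v, huv⟩ := hdab
  have h_one : v * b' + u * a' = 1 := mul_left_cancel₀ hd0 (by linear_combination huv)
  rw [Ideal.eq_top_iff_one, ← h_one]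
  refine Submodule.add_mem_sup (Ideal.mul_mem_left _ _ ?_) (Ideal.mul_mem_left _ _ ?_) <;>
    rw [Ideal.mem_colon_span_singleton, Ideal.mem_span_singleton]
  · exact ⟨a', by ring⟩
  · exact ⟨b', by ring⟩

theorem pid_isBLRing (A : Type*) [CommRing A] [IsDomain A] [IsPrincipalIdealRing A] :
    ∀ I J : Ideal A, Submodule.colon J I + Submodule.colon I J = ⊤ ∧
      I * Submodule.colon J I = I ⊓ J :=
  fun I J => ⟨Ideal.colon_add_colon_eq_top I J, Ideal.mul_colon_eq_inf_of_isPrincipal I J⟩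
end

section
/- Let A be a commutative ring which is a principal ideal domain, and let I, J be nonzero ideals of A. Then (I : (I : J)) = I + J. -/
theorem pid_colon_colon_eq_sup (A : Type*) [CommRing A] [IsDomain A] [IsPrincipalIdealRing A]
    (I J : Ideal A) (hI : I ≠ ⊥) (hJ : J ≠ ⊥) :
    Submodule.colon I (Submodule.colon I J) = I + J := by
  apply le_antisymm
  · obtain ⟨d, hd⟩ := IsPrincipalIdealRing.principal (I + J)
    obtain ⟨c, hc⟩ := IsPrincipalIdealRing.principal I
    rw [← Ideal.span] at hd hc
    have hdc : d ∣ c := by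
      rw [← Ideal.mem_span_singleton, ← hd]
      exact Ideal.mem_sup_left (hc ▸ Ideal.mem_span_singleton_self c)
    obtain ⟨a, rfl⟩ := hdc
    have ha0 : a ≠ 0 := by
      rintro rfl
      simp [hc] at hI
    have ha : a ∈ Submodule.colon I (J : Set A) := by
      rw [Submodule.mem_colon]
      intro y hy
      have hdy : y ∈ I + J := Ideal.mem_sup_right hy
      rw [hd, Ideal.mem_span_singleton] at hdy
      rw [hc, Ideal.mem_span_singleton, smul_eq_mul, mul_comm d a]
      exact mul_dvd_mul_left a hdy
    intro x hx
    have hxa := Submodule.mem_colon.mp hx a ha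
    rw [hc, Ideal.mem_span_singleton, smul_eq_mul] at hxa
    rw [hd, Ideal.mem_span_singleton]
    exact (mul_dvd_mul_iff_right ha0).mp hxa
  · refine sup_le (fun x hx ↦ ?_) fun x hx ↦ ?_ <;> refine Submodule.mem_colon.mpr fun y hy ↦ ?_
    · exact I.mul_mem_right y hx
    · rw [smul_eq_mul, mul_comm]
      exact Submodule.mem_colon.mp hy x hx
end

section
/- Let A be a commutative ring which is a principal ideal domain and let I be an ideal of A. Then the quotient ring A/I is a BL-ring: for all ideals P, Q of A/I, (Q : P) + (P : Q) = A/I and P · (Q : P) = P ∩ Q. -/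
theorem IsBezout.exists_eq_mul_isCoprime {A : Type*} [CommRing A] [IsDomain A] [IsBezout A]
    (p q : A) : ∃ d p' q' : A, p = d * p' ∧ q = d * q' ∧ IsCoprime p' q' := by
  obtain ⟨a, b, hab⟩ := IsBezout.gcd_eq_sum p q
  obtain ⟨p', hp⟩ := IsBezout.gcd_dvd_left p q
  obtain ⟨q', hq⟩ := IsBezout.gcd_dvd_right p q
  generalize IsBezout.gcd p q = d at hab hp hq
  by_cases hd : d = 0
  · exact ⟨0, 1, 0, by simp [hp, hd], by simp [hq, hd], isCoprime_one_left⟩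
  · refine ⟨d, p', q', hp, hq, a, b, mul_left_cancel₀ hd ?_⟩
    linear_combination hab - a * hp - b * hq

theorem Ideal.span_singleton_mul_colon {B : Type*} [CommRing B] (p : B) (Q : Ideal B) :
    Ideal.span {p} * Submodule.colon Q (Ideal.span {p} : Ideal B) = Ideal.span {p} ⊓ Q := by
  ext x
  simp only [Ideal.mem_span_singleton_mul, Ideal.mem_colon_span_singleton, Submodule.mem_inf,
    Ideal.mem_span_singleton']
  constructor
  · rintro ⟨r, hr, rfl⟩
    exact ⟨⟨r, mul_comm r p⟩, mul_comm r p ▸ hr⟩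
  · rintro ⟨⟨r, rfl⟩, hr⟩
    exact ⟨r, hr, mul_comm p r⟩

theorem Ideal.colon_add_colon_eq_top_of_isCoprime {B : Type*} [CommRing B] (d : B) {p q : B}
    (h : IsCoprime p q) :
    Submodule.colon (Ideal.span {d * q}) (Ideal.span {d * p} : Ideal B) +
      Submodule.colon (Ideal.span {d * p}) (Ideal.span {d * q} : Ideal B) = ⊤ := by
  obtain ⟨a, b, hab⟩ := h
  rw [Ideal.eq_top_iff_one, ← hab, add_comm (a * p)]
  refine Submodule.add_mem_sup (Ideal.mul_mem_left _ _ ?_) (Ideal.mul_mem_left _ _ ?_)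
  · exact Ideal.mem_colon_span_singleton.2 (Ideal.mem_span_singleton'.2 ⟨p, by ring⟩)
  · exact Ideal.mem_colon_span_singleton.2 (Ideal.mem_span_singleton'.2 ⟨q, by ring⟩)

theorem quotient_of_pid_isBLRing (A : Type*) [CommRing A] [IsDomain A]
    [IsPrincipalIdealRing A] (I : Ideal A) :
    ∀ P Q : Ideal (A ⧸ I), Submodule.colon Q P + Submodule.colon P Q = ⊤ ∧
      P * Submodule.colon Q P = P ⊓ Q := by
  intro P Q
  have : IsPrincipalIdealRing (A ⧸ I) :=
    IsPrincipalIdealRing.of_surjective (Ideal.Quotient.mk I) Ideal.Quotient.mk_surjective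
  obtain ⟨p, rfl⟩ := (IsPrincipalIdealRing.principal P).principal
  obtain ⟨q, rfl⟩ := (IsPrincipalIdealRing.principal Q).principal
  refine ⟨?_, Ideal.span_singleton_mul_colon p _⟩
  obtain ⟨p, rfl⟩ := Ideal.Quotient.mk_surjective p
  obtain ⟨q, rfl⟩ := Ideal.Quotient.mk_surjective q
  obtain ⟨d, p', q', rfl, rfl, h⟩ := IsBezout.exists_eq_mul_isCoprime p q
  rw [map_mul, map_mul]
  exact Ideal.colon_add_colon_eq_top_of_isCoprime _ (h.map (Ideal.Quotient.mk I))
end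

section
/- Let A = ℤ_{k₁} × ℤ_{k₂} × ... × ℤ_{k_r} be a finite commutative unitary ring, where k_i = p_i^{α_i} with p_1, ..., p_r distinct prime numbers and α_i ≥ 1. Then A is a BL-ring: for all ideals I, J of A, (J : I) + (I : J) = A and I · (J : I) = I ∩ J. Moreover, Ann(Ann(I)) = I for every ideal I of A, where Ann(I) = (0 : I). -/
/-- Divisibility by `p ^ b` in `ZMod (p ^ n)` is divisibility of representatives. -/
theorem ZMod.pow_dvd_natCast_iff {p n b : ℕ} [NeZero (p ^ n)] (hb : b ≤ n) (m : ℕ) :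
    (p : ZMod (p ^ n)) ^ b ∣ (m : ZMod (p ^ n)) ↔ p ^ b ∣ m := by
  constructor
  · rintro ⟨c, hc⟩
    obtain ⟨c, rfl⟩ := ZMod.natCast_zmod_surjective c
    have h : m ≡ p ^ b * c [MOD p ^ n] := by
      rw [← ZMod.natCast_eq_natCast_iff]
      exact_mod_cast hc
    exact (h.dvd_iff (pow_dvd_pow p hb)).2 (dvd_mul_right _ _)
  · intro h
    exact_mod_cast Nat.cast_dvd_cast (α := ZMod (p ^ n)) h

theorem ZMod.pow_dvd_mul_pow_iff {p n a b : ℕ} (hp : p.Prime) (hb : b ≤ n) (x : ZMod (p ^ n)) :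
    (p : ZMod (p ^ n)) ^ b ∣ x * (p : ZMod (p ^ n)) ^ a ↔
      (p : ZMod (p ^ n)) ^ (b - a) ∣ x := by
  have : NeZero (p ^ n) := ⟨pow_ne_zero _ hp.ne_zero⟩
  obtain ⟨m, rfl⟩ := ZMod.natCast_zmod_surjective x
  rw [ZMod.pow_dvd_natCast_iff ((Nat.sub_le b a).trans hb), ← Nat.cast_pow p a, ← Nat.cast_mul,
    ZMod.pow_dvd_natCast_iff hb]
  rcases le_total b a with h | h
  · simpa [Nat.sub_eq_zero_of_le h] using (pow_dvd_pow p h).mul_left m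
  · rw [← Nat.sub_add_cancel h, pow_add, Nat.mul_dvd_mul_iff_right (pow_pos hp.pos a),
      Nat.add_sub_cancel]

theorem ZMod.exists_pow_dvd_and_dvd_pow {p : ℕ} (hp : p.Prime) (n : ℕ) (x : ZMod (p ^ n)) :
    ∃ a ≤ n, (p : ZMod (p ^ n)) ^ a ∣ x ∧ x ∣ (p : ZMod (p ^ n)) ^ a := by
  have : NeZero (p ^ n) := ⟨pow_ne_zero _ hp.ne_zero⟩
  obtain ⟨m, rfl⟩ := ZMod.natCast_zmod_surjective x
  obtain ⟨a, ha, h⟩ := (Nat.dvd_prime_pow hp).1 (Nat.gcd_dvd_right m (p ^ n))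
  refine ⟨a, ha, (ZMod.pow_dvd_natCast_iff ha m).2 (h ▸ Nat.gcd_dvd_left _ _), ?_⟩
  refine ⟨(m.gcdA (p ^ n) : ZMod (p ^ n)), ?_⟩
  have e := congrArg (Int.cast : ℤ → ZMod (p ^ n)) (Nat.gcd_eq_gcd_ab m (p ^ n))
  rw [h] at e
  have z : (p : ZMod (p ^ n)) ^ n = 0 := by exact_mod_cast ZMod.natCast_self (p ^ n)
  simpa [z] using e

section PrimePowers

variable {ι : Type*} {p n : ι → ℕ}

/-- The ideal of a product of rings `ZMod (p i ^ n i)` generated by the powers `p i ^ a i`. -/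
def ZMod.piPowIdeal (p n a : ι → ℕ) : Ideal (∀ i, ZMod (p i ^ n i)) :=
  Ideal.span {fun i ↦ (p i : ZMod (p i ^ n i)) ^ a i}

theorem ZMod.mem_piPowIdeal {a : ι → ℕ} {x : ∀ i, ZMod (p i ^ n i)} :
    x ∈ piPowIdeal p n a ↔ ∀ i, (p i : ZMod (p i ^ n i)) ^ a i ∣ x i := by
  rw [piPowIdeal, Ideal.mem_span_singleton, pi_dvd_iff]

theorem ZMod.exists_eq_piPowIdeal [Finite ι] (hp : ∀ i, (p i).Prime)
    (I : Ideal (∀ i, ZMod (p i ^ n i))) : ∃ a ≤ n, I = piPowIdeal p n a := by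
  have (i : ι) : IsPrincipalIdealRing (ZMod (p i ^ n i)) :=
    IsPrincipalIdealRing.of_surjective (Int.castRingHom _) ZMod.intCast_surjective
  obtain ⟨f, rfl⟩ := IsPrincipalIdealRing.principal I
  choose a ha hf hf' using fun i ↦ exists_pow_dvd_and_dvd_pow (hp i) (n i) (f i)
  refine ⟨a, ha, le_antisymm ?_ ?_⟩
  · exact (Ideal.span_singleton_le_iff_mem _).2 (mem_piPowIdeal.2 hf)
  · exact Ideal.span_singleton_le_span_singleton.2 (pi_dvd_iff.2 hf')

theorem ZMod.colon_piPowIdeal (hp : ∀ i, (p i).Prime) {a b : ι → ℕ} (hb : b ≤ n) :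
    (piPowIdeal p n b).colon (piPowIdeal p n a) = piPowIdeal p n (b - a) := by
  ext x
  rw [piPowIdeal.eq_def p n a, Ideal.mem_colon_span_singleton, mem_piPowIdeal, mem_piPowIdeal]
  exact forall_congr' fun i ↦ pow_dvd_mul_pow_iff (hp i) (hb i) (x i)

theorem ZMod.piPowIdeal_mul (a b : ι → ℕ) :
    piPowIdeal p n a * piPowIdeal p n b = piPowIdeal p n (a + b) := by
  simp only [piPowIdeal, Ideal.span_singleton_mul_span_singleton, Pi.add_apply, pow_add]
  rfl

theorem ZMod.piPowIdeal_inf (a b : ι → ℕ) :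
    piPowIdeal p n a ⊓ piPowIdeal p n b = piPowIdeal p n (a ⊔ b) := by
  ext x
  simp only [Ideal.mem_inf, mem_piPowIdeal, ← forall_and, Pi.sup_apply]
  refine forall_congr' fun i ↦ ⟨fun h ↦ ?_, fun h ↦
    ⟨(pow_dvd_pow _ le_sup_left).trans h, (pow_dvd_pow _ le_sup_right).trans h⟩⟩
  rcases le_total (a i) (b i) with hab | hab
  · rw [sup_eq_right.2 hab]
    exact h.2
  · rw [sup_eq_left.2 hab]
    exact h.1

theorem ZMod.piPowIdeal_sup_eq_top {a b : ι → ℕ} (h : ∀ i, a i = 0 ∨ b i = 0) :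
    piPowIdeal p n a ⊔ piPowIdeal p n b = ⊤ := by
  classical
  rw [Ideal.eq_top_iff_one, Submodule.mem_sup]
  refine ⟨fun i ↦ if a i = 0 then 1 else 0, mem_piPowIdeal.2 fun i ↦ ?_,
    fun i ↦ if a i = 0 then 0 else 1, mem_piPowIdeal.2 fun i ↦ ?_, ?_⟩
  · by_cases ha : a i = 0 <;> simp [ha]
  · by_cases ha : a i = 0
    · simp [ha]
    · simp [(h i).resolve_left ha]
  · ext i
    by_cases ha : a i = 0 <;> simp [ha]

theorem ZMod.piPowIdeal_self (p n : ι → ℕ) : piPowIdeal p n n = ⊥ := by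
  rw [piPowIdeal, Ideal.span_singleton_eq_bot]
  ext i
  exact_mod_cast ZMod.natCast_self (p i ^ n i)

end PrimePowers

theorem prod_zmod_prime_pow_isBLRing (r : ℕ) (p α : Fin r → ℕ)
    (hp : ∀ i, (p i).Prime) (hdist : ∀ i j, i ≠ j → p i ≠ p j)
    (hα : ∀ i, 1 ≤ α i) (k : Fin r → ℕ) (hk : ∀ i, k i = p i ^ α i) :
    (∀ I J : Ideal (∀ i, ZMod (k i)),
        Submodule.colon J I + Submodule.colon I J = ⊤ ∧
          I * Submodule.colon J I = I ⊓ J) ∧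
      (∀ I : Ideal (∀ i, ZMod (k i)),
        Submodule.colon (⊥ : Ideal (∀ i, ZMod (k i)))
          (Submodule.colon (⊥ : Ideal (∀ i, ZMod (k i))) I) = I) := by
  obtain rfl : k = fun i ↦ p i ^ α i := funext hk
  refine ⟨fun I J ↦ ?_, fun I ↦ ?_⟩
  · obtain ⟨a, ha, rfl⟩ := ZMod.exists_eq_piPowIdeal hp I
    obtain ⟨b, hb, rfl⟩ := ZMod.exists_eq_piPowIdeal hp J
    rw [ZMod.colon_piPowIdeal hp hb, ZMod.colon_piPowIdeal hp ha, ZMod.piPowIdeal_mul,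
      ZMod.piPowIdeal_inf]
    refine ⟨ZMod.piPowIdeal_sup_eq_top fun i ↦ ?_, congrArg _ (funext fun i ↦ ?_)⟩
    · simp only [Pi.sub_apply]
      lia
    · simp only [Pi.add_apply, Pi.sub_apply, Pi.sup_apply]
      lia
  · obtain ⟨a, ha, rfl⟩ := ZMod.exists_eq_piPowIdeal hp I
    rw [← ZMod.piPowIdeal_self, ZMod.colon_piPowIdeal hp le_rfl, ZMod.colon_piPowIdeal hp le_rfl]
    exact congrArg _ (funext fun i ↦ Nat.sub_sub_self (ha i))
end

section
/- Let K be a field, f a nonzero polynomial in K[X], and A = K[X]/(f). Then Ann(Ann(I)) = I for every ideal I of A, where Ann(I) = (0 : I) is the annihilator of I. -/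
set_option synthInstance.maxHeartbeats 1000000
set_option maxHeartbeats 2000000

/-- In the quotient of a principal ideal domain by a nonzero element, every ideal is its own
double annihilator. -/
theorem colon_bot_colon_bot_eq_self_of_quotient_span_singleton {R : Type*} [CommRing R]
    [IsDomain R] [IsPrincipalIdealRing R] {a : R} (ha : a ≠ 0)
    (I : Ideal (R ⧸ Ideal.span {a})) :
    Submodule.colon (⊥ : Ideal (R ⧸ Ideal.span {a}))
      (Submodule.colon (⊥ : Ideal (R ⧸ Ideal.span {a})) I) = I := by
  apply le_antisymm
  · intro x hx
    obtain ⟨p, rfl⟩ := Ideal.Quotient.mk_surjective x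
    obtain ⟨g, hg⟩ := IsPrincipalIdealRing.principal (I.comap (Ideal.Quotient.mk (Ideal.span {a})))
    have mem_iff (q : R) : Ideal.Quotient.mk (Ideal.span {a}) q ∈ I ↔ g ∣ q := by
      rw [← Ideal.mem_comap, hg]
      exact Ideal.mem_span_singleton
    obtain ⟨h, rfl⟩ : g ∣ a := by
      rw [← mem_iff, Ideal.Quotient.eq_zero_iff_mem.2 (Ideal.mem_span_singleton_self a)]
      exact I.zero_mem
    have hh : Ideal.Quotient.mk (Ideal.span {g * h}) h ∈
        Submodule.colon (⊥ : Ideal (R ⧸ Ideal.span {g * h})) I := by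
      refine Submodule.mem_colon.2 fun y hy ↦ ?_
      obtain ⟨q, rfl⟩ := Ideal.Quotient.mk_surjective y
      obtain ⟨c, rfl⟩ := (mem_iff q).1 hy
      rw [Submodule.mem_bot, smul_eq_mul, ← map_mul, Ideal.Quotient.eq_zero_iff_mem,
        Ideal.mem_span_singleton]
      exact ⟨c, by ring⟩
    have hp := Submodule.mem_colon.1 hx _ hh
    rw [Submodule.mem_bot, smul_eq_mul, ← map_mul, Ideal.Quotient.eq_zero_iff_mem,
      Ideal.mem_span_singleton] at hp
    exact (mem_iff p).2 ((mul_dvd_mul_iff_right (right_ne_zero_of_mul ha)).1 hp)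
  · intro x hx
    refine Submodule.mem_colon.2 fun y hy ↦ ?_
    rw [smul_eq_mul, mul_comm]
    exact Submodule.mem_colon.1 hy x hx

open Polynomial in
theorem ann_ann_eq_self_in_field_poly_quot (K : Type*) [Field K]
    (f : Polynomial K) (hf : f ≠ 0) :
    ∀ I : Ideal (Polynomial K ⧸ Ideal.span {f}),
      Submodule.colon (⊥ : Ideal (Polynomial K ⧸ Ideal.span {f}))
        (Submodule.colon (⊥ : Ideal (Polynomial K ⧸ Ideal.span {f})) I) = I :=
  colon_bot_colon_bot_eq_self_of_quotient_span_singleton hf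
end
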